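/- There exist constants L ≥ 2 and C > 0, depending only on n, M, β, with the following property: for every admissible drift B, every Green's function g of L = −Δ + B·∇ on Ω with pole at 0, and all minimum points p₀, p₁, p₂ of g with 0 < |p₀| ≤ |p₁| ≤ |p₂| ≤ 1/L, one has g(p₁) − g(p₂) ≥ 2C · |∂g/∂r(p₀)| · |p₀|^{n−1} · (|p₁|^{2−n} − |p₂|^{2−n}). -/

import Mathlib

open Set Metric MeasureTheory Filter
open scoped RealInnerProductSpace Topology

noncomputable section

/-- Euclidean space `ℝⁿ`. -/
abbrev Euc (n : ℕ) := EuclideanSpace ℝ (Fin n)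

/-- The divergence `div B x = ∑ i ∂ᵢ Bᵢ (x)` of a vector field. -/
def divg {n : ℕ} (B : Euc n → Euc n) (x : Euc n) : ℝ :=
  ∑ i : Fin n, ⟪fderiv ℝ B x (EuclideanSpace.single i 1), EuclideanSpace.single i (1 : ℝ)⟫

/-- An admissible drift on the unit ball `Ω = B(0,1)`: `B` is continuously differentiable on
`Ω`, `δ(x)^(1-β) |B(x)| ≤ M` on `Ω` (where `δ(x) = 1 - |x|`), and
`-M δ(x)^(β-2) ≤ div B(x) ≤ 0` on `Ω`. -/
def AdmissibleDrift {n : ℕ} (β M : ℝ) (B : Euc n → Euc n) : Prop :=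
  ContDiffOn ℝ 1 B (ball 0 1) ∧
  (∀ x ∈ ball (0 : Euc n) 1, (1 - ‖x‖) ^ (1 - β) * ‖B x‖ ≤ M) ∧
  (∀ x ∈ ball (0 : Euc n) 1, -(M * (1 - ‖x‖) ^ (β - 2)) ≤ divg B x ∧ divg B x ≤ 0)

/-- A Green's function of `L = -Δ + B·∇` on the unit ball `Ω = B(0,1)` with pole at `y`:
positive on `Ω \ {y}`, three times continuously differentiable there, `g` and `|∇g|`
integrable on `Ω`, `g(x) → 0` as `|x| → 1`, and the weak formulation
`∫_Ω (⟨∇g, ∇φ⟩ + ⟨B, ∇g⟩ φ) = φ(y)` for every test function `φ ∈ C_c^∞(Ω)`. -/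
def IsGreenPole {n : ℕ} (B : Euc n → Euc n) (y : Euc n) (g : Euc n → ℝ) : Prop :=
  (∀ x ∈ ball (0 : Euc n) 1, x ≠ y → 0 < g x) ∧
  ContDiffOn ℝ 3 g (ball 0 1 \ {y}) ∧
  IntegrableOn g (ball 0 1) ∧
  IntegrableOn (fun x => ‖gradient g x‖) (ball 0 1) ∧
  (∀ ε > 0, ∃ t < (1 : ℝ), ∀ x ∈ ball (0 : Euc n) 1, t < ‖x‖ → |g x| < ε) ∧
  (∀ φ : Euc n → ℝ, ContDiff ℝ (⊤ : ℕ∞) φ → HasCompactSupport φ → tsupport φ ⊆ ball 0 1 →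
    (∫ x in ball (0 : Euc n) 1,
      (⟪gradient g x, gradient φ x⟫ + ⟪B x, gradient g x⟫ * φ x)) = φ y)


/-- `p ∈ Ω \ {0}` is a minimum point of `g` if it is at minimal distance from the origin
on its own level set `{x ∈ Ω \ {0} : g x = g p}`. -/
def IsMinPoint {n : ℕ} (g : Euc n → ℝ) (p : Euc n) : Prop :=
  p ∈ ball (0 : Euc n) 1 ∧ p ≠ 0 ∧
    ∀ x ∈ ball (0 : Euc n) 1, x ≠ 0 → g x = g p → ‖p‖ ≤ ‖x‖

/-- The radial derivative `∂g/∂r (p) = ⟨∇g(p), p/|p|⟩`. -/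
def radialDeriv {n : ℕ} (g : Euc n → ℝ) (p : Euc n) : ℝ :=
  ⟪gradient g p, ‖p‖⁻¹ • p⟫

section IntegrationByParts

variable {n : ℕ} {U : Set (Euc n)}

lemma integrable_mul_of_tsupport_subset {f w : Euc n → ℝ} (hf : ContinuousOn f U)
    (hw : Continuous w) (hcs : HasCompactSupport w) (hsub : tsupport w ⊆ U) :
    Integrable (fun x => f x * w x) := by
  rw [← integrableOn_iff_integrable_of_support_subset (s := tsupport w)]
  · exact ((hf.mono hsub).mul hw.continuousOn).integrableOn_compact hcs
  · intro x hx
    exact subset_tsupport _ (right_ne_zero_of_mul hx)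

/-- Integration by parts against a compactly supported function. -/
lemma integral_mul_fderiv_eq_neg_of_tsupport_subset {u w : Euc n → ℝ} (hU : IsOpen U)
    (hu : ContDiffOn ℝ 1 u U) (hw : ContDiff ℝ 1 w) (hcs : HasCompactSupport w)
    (hsub : tsupport w ⊆ U) (v : Euc n) :
    ∫ x, u x * fderiv ℝ w x v = - ∫ x, fderiv ℝ u x v * w x := by
  have hdu : ∀ x ∈ U, DifferentiableAt ℝ u x := fun x hx =>
    (hu.differentiableOn one_ne_zero x hx).differentiableAt (hU.mem_nhds hx)
  have hcu : ContinuousOn (fun x => fderiv ℝ u x v) U :=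
    (hu.continuousOn_fderiv_of_isOpen hU le_rfl).clm_apply continuousOn_const
  have hcw : Continuous (fun x => fderiv ℝ w x v) :=
    (hw.continuous_fderiv one_ne_zero).clm_apply continuous_const
  refine integral_bilinear_hasLineDerivAt_right_eq_neg_left_of_integrable
    (f := u) (g := w) (v := v) (B := ContinuousLinearMap.mul ℝ ℝ) ?_ ?_ ?_ ?_ ?_
  · exact integrable_mul_of_tsupport_subset hcu hw.continuous hcs hsub
  · exact integrable_mul_of_tsupport_subset hu.continuousOn hcw (hcs.fderiv_apply (𝕜 := ℝ) v)
      ((tsupport_fderiv_apply_subset ℝ v).trans hsub)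
  · exact integrable_mul_of_tsupport_subset hu.continuousOn hw.continuous hcs hsub
  · exact fun x hx => (hdu x (hsub hx)).hasFDerivAt.hasLineDerivAt v
  · exact fun x _ => ((hw.differentiable one_ne_zero) x).hasFDerivAt.hasLineDerivAt v

end IntegrationByParts

section Laplacian

variable {n : ℕ}

/-- The Laplacian `∑ i, ∂ᵢ∂ᵢ u (x)` as an iterated Fréchet derivative. -/
def coordLaplacian (u : Euc n → ℝ) (x : Euc n) : ℝ :=
  ∑ i : Fin n, fderiv ℝ (fun y => fderiv ℝ u y (EuclideanSpace.single i 1)) x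
    (EuclideanSpace.single i 1)

lemma inner_gradient_eq_fderiv (u : Euc n → ℝ) (x v : Euc n) :
    ⟪gradient u x, v⟫ = fderiv ℝ u x v := by
  simp [gradient, InnerProductSpace.toDual_symm_apply]

lemma inner_gradient_gradient (u w : Euc n → ℝ) (x : Euc n) :
    ⟪gradient u x, gradient w x⟫ = ∑ i : Fin n,
      fderiv ℝ u x (EuclideanSpace.single i 1) * fderiv ℝ w x (EuclideanSpace.single i 1) := by
  rw [← (EuclideanSpace.basisFun (Fin n) ℝ).sum_inner_mul_inner]
  refine Finset.sum_congr rfl fun i _ => ?_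
  rw [inner_gradient_eq_fderiv, real_inner_comm (gradient w x), inner_gradient_eq_fderiv]
  simp

lemma continuousOn_gradient {u : Euc n → ℝ} {U : Set (Euc n)} (hU : IsOpen U)
    (hu : ContDiffOn ℝ 1 u U) : ContinuousOn (gradient u) U :=
  (InnerProductSpace.toDual ℝ (Euc n)).symm.continuous.comp_continuousOn
    (hu.continuousOn_fderiv_of_isOpen hU le_rfl)

lemma contDiffOn_fderiv_apply {u : Euc n → ℝ} {U : Set (Euc n)} (hU : IsOpen U)
    {m k : WithTop ℕ∞} (hmk : m + 1 ≤ k) (hu : ContDiffOn ℝ k u U) (v : Euc n) :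
    ContDiffOn ℝ m (fun y => fderiv ℝ u y v) U :=
  (hu.fderiv_of_isOpen hU hmk).clm_apply contDiffOn_const

lemma continuousOn_coordLaplacian {u : Euc n → ℝ} {U : Set (Euc n)} (hU : IsOpen U)
    (hu : ContDiffOn ℝ 2 u U) : ContinuousOn (coordLaplacian u) U := by
  refine continuousOn_finsetSum _ fun i _ => ?_
  have h1 := contDiffOn_fderiv_apply hU (m := 1) (k := 2) (by norm_num) hu
    (EuclideanSpace.single i 1)
  exact (h1.continuousOn_fderiv_of_isOpen hU le_rfl).clm_apply continuousOn_const

/-- Green's first identity for a test function supported where `u` is smooth. -/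
lemma integral_inner_gradient_eq_neg_laplacian_mul {u w : Euc n → ℝ} {U : Set (Euc n)}
    (hU : IsOpen U) (hu : ContDiffOn ℝ 2 u U) (hw : ContDiff ℝ 1 w)
    (hcs : HasCompactSupport w) (hsub : tsupport w ⊆ U) :
    ∫ x, ⟪gradient u x, gradient w x⟫ = - ∫ x, coordLaplacian u x * w x := by
  have h1 : ∀ i : Fin n, ContDiffOn ℝ 1 (fun y => fderiv ℝ u y (EuclideanSpace.single i 1)) U :=
    fun i => contDiffOn_fderiv_apply hU (by norm_num) hu _
  simp_rw [inner_gradient_gradient, coordLaplacian, Finset.sum_mul]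
  rw [integral_finsetSum, integral_finsetSum, ← Finset.sum_neg_distrib]
  · exact Finset.sum_congr rfl fun i _ =>
      integral_mul_fderiv_eq_neg_of_tsupport_subset hU (h1 i) hw hcs hsub _
  · exact fun i _ => integrable_mul_of_tsupport_subset
      (((h1 i).continuousOn_fderiv_of_isOpen hU le_rfl).clm_apply continuousOn_const)
      hw.continuous hcs hsub
  · exact fun i _ => integrable_mul_of_tsupport_subset (h1 i).continuousOn
      ((hw.continuous_fderiv one_ne_zero).clm_apply continuous_const)
      (hcs.fderiv_apply (𝕜 := ℝ) _) ((tsupport_fderiv_apply_subset ℝ _).trans hsub)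

/-- Green's first identity for a test function whose gradient is supported where `u` is smooth. -/
lemma integral_inner_gradient_eq_neg_mul_laplacian {u w : Euc n → ℝ} {U : Set (Euc n)}
    (hU : IsOpen U) (hu : ContDiffOn ℝ 1 u U) (hw : ContDiff ℝ 2 w)
    (hcs : HasCompactSupport w) (hsub : tsupport (fderiv ℝ w) ⊆ U) :
    ∫ x, ⟪gradient u x, gradient w x⟫ = - ∫ x, u x * coordLaplacian w x := by
  have h1 : ∀ i : Fin n, ContDiff ℝ 1 (fun y => fderiv ℝ w y (EuclideanSpace.single i 1)) :=
    fun i => (hw.fderiv_right (by norm_num)).clm_apply contDiff_const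
  have hs : ∀ i : Fin n,
      tsupport (fun y => fderiv ℝ w y (EuclideanSpace.single i 1)) ⊆ U := fun i =>
    (tsupport_comp_subset (g := fun L : Euc n →L[ℝ] ℝ => L (EuclideanSpace.single i 1)) rfl
      _).trans hsub
  have hc : ∀ i : Fin n,
      HasCompactSupport (fun y => fderiv ℝ w y (EuclideanSpace.single i 1)) :=
    fun i => hcs.fderiv_apply (𝕜 := ℝ) _
  simp_rw [inner_gradient_gradient, coordLaplacian, Finset.mul_sum]
  rw [integral_finsetSum, integral_finsetSum, ← Finset.sum_neg_distrib]
  · exact Finset.sum_congr rfl fun i _ => by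
      rw [integral_mul_fderiv_eq_neg_of_tsupport_subset hU hu (h1 i) (hc i) (hs i), neg_neg]
  · exact fun i _ => integrable_mul_of_tsupport_subset hu.continuousOn
      (((h1 i).continuous_fderiv one_ne_zero).clm_apply continuous_const)
      ((hc i).fderiv_apply (𝕜 := ℝ) _) ((tsupport_fderiv_apply_subset ℝ _).trans (hs i))
  · exact fun i _ => integrable_mul_of_tsupport_subset
      ((hu.continuousOn_fderiv_of_isOpen hU le_rfl).clm_apply continuousOn_const)
      (h1 i).continuous (hc i) (hs i)

end Laplacian

section GreenFunction

variable {n : ℕ}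

lemma integrable_inner_gradient {u w : Euc n → ℝ} {U : Set (Euc n)} (hU : IsOpen U)
    (hu : ContDiffOn ℝ 1 u U) (hw : ContDiff ℝ 1 w)
    (hcs : HasCompactSupport w) (hsub : tsupport (fderiv ℝ w) ⊆ U) :
    Integrable (fun x => ⟪gradient u x, gradient w x⟫) := by
  simp_rw [inner_gradient_gradient]
  exact integrable_finsetSum _ fun i _ => integrable_mul_of_tsupport_subset
    ((hu.continuousOn_fderiv_of_isOpen hU le_rfl).clm_apply continuousOn_const)
    ((hw.continuous_fderiv one_ne_zero).clm_apply continuous_const)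
    (hcs.fderiv_apply (𝕜 := ℝ) _)
    ((tsupport_comp_subset (g := fun L : Euc n →L[ℝ] ℝ => L (EuclideanSpace.single i 1)) rfl
      _).trans hsub)

lemma isOpen_ball_diff_zero : IsOpen (ball (0 : Euc n) 1 \ {0}) :=
  isOpen_ball.sdiff isClosed_singleton

/-- The drift is bounded by `2 * M` on the ball of radius `1 / 2`. -/
lemma AdmissibleDrift.norm_le {β M : ℝ} (hβ0 : 0 < β) (hβ1 : β < 1) {B : Euc n → Euc n}
    (hB : AdmissibleDrift β M B) {x : Euc n} (hx : ‖x‖ ≤ 1 / 2) : ‖B x‖ ≤ 2 * M := by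
  have h1 := hB.2.1 x (by simp; linarith)
  have h2 : (1 / 2 : ℝ) ≤ (1 - ‖x‖) ^ (1 - β) := by
    have h3 : (1 / 2 : ℝ) ≤ 1 - ‖x‖ := by linarith
    calc (1 / 2 : ℝ) ≤ 1 - ‖x‖ := h3
      _ = (1 - ‖x‖) ^ (1 : ℝ) := (Real.rpow_one _).symm
      _ ≤ (1 - ‖x‖) ^ (1 - β) := Real.rpow_le_rpow_of_exponent_ge (by linarith)
        (by linarith [norm_nonneg x]) (by linarith)
  nlinarith [norm_nonneg (B x)]

/-- A Green's function solves the equation classically away from the pole. -/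
lemma IsGreenPole.coordLaplacian_eq {β M : ℝ} {B : Euc n → Euc n} {g : Euc n → ℝ}
    (hB : AdmissibleDrift β M B) (hg : IsGreenPole B 0 g) {x : Euc n}
    (hx : x ∈ ball (0 : Euc n) 1 \ {0}) : coordLaplacian g x = ⟪B x, gradient g x⟫ := by
  obtain ⟨-, hg3, -, -, -, hweak⟩ := hg
  set U := ball (0 : Euc n) 1 \ {0} with hUdef
  have hU : IsOpen U := isOpen_ball_diff_zero
  have hBc : ContinuousOn B U := hB.1.continuousOn.mono sdiff_subset
  have hg2 : ContDiffOn ℝ 2 g U := hg3.of_le (by norm_num)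
  have hg1 : ContDiffOn ℝ 1 g U := hg3.of_le (by norm_num)
  have hLc := continuousOn_coordLaplacian hU hg2
  have hDc : ContinuousOn (fun x => ⟪B x, gradient g x⟫) U :=
    hBc.inner (𝕜 := ℝ) (continuousOn_gradient hU hg1)
  have hfc : ContinuousOn (fun x => ⟪B x, gradient g x⟫ - coordLaplacian g x) U := hDc.sub hLc
  have hae := hU.ae_eq_zero_of_integral_contDiff_smul_eq_zero (μ := volume)
    (hfc.locallyIntegrableOn hU.measurableSet) (fun w hw hcs hsub => by
      have hw1 : ContDiff ℝ 1 w := hw.of_le (by exact_mod_cast le_top)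
      have key := hweak w hw hcs (hsub.trans sdiff_subset)
      have hw0 : w 0 = 0 := image_eq_zero_of_notMem_tsupport fun h => (hsub h).2 rfl
      have hfd : tsupport (fderiv ℝ w) ⊆ U := (tsupport_fderiv_subset ℝ).trans hsub
      rw [hw0, setIntegral_eq_integral_of_forall_compl_eq_zero, integral_add
        (integrable_inner_gradient hU hg1 hw1 hcs hfd)
        (integrable_mul_of_tsupport_subset hDc hw1.continuous hcs hsub),
        integral_inner_gradient_eq_neg_laplacian_mul hU hg2 hw1 hcs hsub] at key
      · simp only [smul_eq_mul, mul_comm (w _), sub_mul]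
        rw [integral_sub (integrable_mul_of_tsupport_subset hDc hw1.continuous hcs hsub)
          (integrable_mul_of_tsupport_subset hLc hw1.continuous hcs hsub)]
        linarith
      · intro y hy
        have h1 : y ∉ tsupport w := fun h => hy (hsub h).1
        have h2 : fderiv ℝ w y = 0 :=
          image_eq_zero_of_notMem_tsupport fun h => hy (hfd h).1
        simp [gradient, h2, image_eq_zero_of_notMem_tsupport h1])
  have := Measure.eqOn_open_of_ae_eq (μ := volume) (g := fun _ => (0 : ℝ))
    ((ae_restrict_iff' hU.measurableSet).2 hae) hU hfc continuousOn_const hx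
  simp only at this
  linarith

lemma coordLaplacian_comp_smul (w : Euc n → ℝ) (c : ℝ) (x : Euc n) :
    coordLaplacian (fun y => w (c • y)) x = c ^ 2 * coordLaplacian w (c • x) := by
  simp only [coordLaplacian, Finset.mul_sum]
  refine Finset.sum_congr rfl fun i _ => ?_
  have h1 : (fun y => fderiv ℝ (fun z => w (c • z)) y (EuclideanSpace.single i 1)) =
      fun y => c * (fun z => fderiv ℝ w z (EuclideanSpace.single i 1)) (c • y) := by
    ext y
    rw [fderiv_comp_smul]
    simp
  rw [h1]
  change fderiv ℝ (c • fun y => (fun z => fderiv ℝ w z (EuclideanSpace.single i 1)) (c • y)) x _ = _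
  rw [fderiv_const_smul_field, Pi.smul_apply,
    fderiv_comp_smul (f := fun z => fderiv ℝ w z (EuclideanSpace.single i 1))]
  simp only [smul_apply, smul_eq_mul]
  ring

lemma coordLaplacian_eq_zero_of_notMem_tsupport_fderiv {w : Euc n → ℝ} {x : Euc n}
    (hx : x ∉ tsupport (fderiv ℝ w)) : coordLaplacian w x = 0 := by
  refine Finset.sum_eq_zero fun i _ => ?_
  have h : x ∉ tsupport (fun y => fderiv ℝ w y (EuclideanSpace.single i 1)) := fun h =>
    hx (tsupport_comp_subset (g := fun L : Euc n →L[ℝ] ℝ => L (EuclideanSpace.single i 1)) rfl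
      _ h)
  rw [image_eq_zero_of_notMem_tsupport fun h' => h (tsupport_fderiv_subset ℝ h')]
  rfl

lemma tsupport_fderiv_bump_subset (η : ContDiffBump (0 : Euc n)) {ε : ℝ} (hε : 0 < ε) :
    tsupport (fderiv ℝ fun y => η (ε⁻¹ • y)) ⊆
      {x | ε * η.rIn ≤ ‖x‖ ∧ ‖x‖ ≤ ε * η.rOut} := by
  refine closure_minimal ?_ ((isClosed_le continuous_const continuous_norm).inter
    (isClosed_le continuous_norm continuous_const))
  intro x hx
  have hn : ∀ y : Euc n, ‖ε⁻¹ • y‖ = ‖y‖ / ε := fun y => by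
    rw [norm_smul, norm_inv, Real.norm_of_nonneg hε.le, inv_mul_eq_div]
  by_contra hcon
  apply hx
  rcases not_and_or.1 hcon with h | h
  · have : (fun y => η (ε⁻¹ • y)) =ᶠ[𝓝 x] fun _ => 1 := by
      filter_upwards [(isOpen_lt continuous_norm continuous_const).mem_nhds
        (not_le.1 h : ‖x‖ < ε * η.rIn)] with y hy
      apply η.one_of_mem_closedBall
      rw [mem_closedBall_zero_iff, hn, div_le_iff₀' hε]
      exact le_of_lt hy
    rw [this.fderiv_eq, fderiv_fun_const]
    rfl
  · have : (fun y => η (ε⁻¹ • y)) =ᶠ[𝓝 x] fun _ => 0 := by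
      filter_upwards [(isOpen_lt continuous_const continuous_norm).mem_nhds
        (not_le.1 h : ε * η.rOut < ‖x‖)] with y hy
      apply η.zero_of_le_dist
      rw [dist_zero_right, hn, le_div_iff₀' hε]
      exact le_of_lt hy
    rw [this.fderiv_eq, fderiv_fun_const]
    rfl

/-- A Green's function is unbounded near its pole. -/
lemma IsGreenPole.not_bounded_near_pole (hn : 3 ≤ n) {β M : ℝ} (hβ0 : 0 < β) (hβ1 : β < 1)
    {B : Euc n → Euc n} {g : Euc n → ℝ}
    (hB : AdmissibleDrift β M B) (hg : IsGreenPole B 0 g) {A ρ : ℝ} (hρ : 0 < ρ) :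
    ¬ ∀ x : Euc n, x ≠ 0 → ‖x‖ < ρ → g x ≤ A := by
  intro hA
  obtain ⟨hpos, hg3, -, hgi, -, hweak⟩ := hg
  have hU : IsOpen (ball (0 : Euc n) 1 \ {0}) := isOpen_ball_diff_zero
  have hg1 : ContDiffOn ℝ 1 g (ball (0 : Euc n) 1 \ {0}) := hg3.of_le (by norm_num)
  let η : ContDiffBump (0 : Euc n) := ⟨1, 2, one_pos, one_lt_two⟩
  have hη2 : ContDiff ℝ 2 η := η.contDiff
  have hLη : Continuous (coordLaplacian η) := by
    rw [← continuousOn_univ]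
    exact continuousOn_coordLaplacian isOpen_univ hη2.contDiffOn
  have hLηcs : HasCompactSupport (coordLaplacian η) :=
    (η.hasCompactSupport.fderiv (𝕜 := ℝ)).mono' fun x hx => by
      by_contra h
      exact hx (coordLaplacian_eq_zero_of_notMem_tsupport_fderiv h)
  obtain ⟨C, hC⟩ := hLηcs.exists_bound_of_continuous hLη
  have hC0 : 0 ≤ C := (norm_nonneg _).trans (hC 0)
  have hM0 : 0 ≤ 2 * M := (norm_nonneg _).trans (hB.norm_le hβ0 hβ1 (x := 0) (by simp))
  set V : ℝ := volume.real (ball (0 : Euc n) 1) with hV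
  have hbound : ∀ ε : ℝ, 0 < ε → 2 * ε < ρ → 2 * ε ≤ 1 / 2 →
      1 ≤ |A| * ((ε⁻¹) ^ 2 * C) * ((2 * ε) ^ n * V) +
        ∫ x in ball (0 : Euc n) 1 ∩ closedBall 0 (2 * ε), 2 * M * ‖gradient g x‖ := by
    intro ε hε hερ hε2
    set w : Euc n → ℝ := fun y => η (ε⁻¹ • y) with hw
    have hwc : ContDiff ℝ (⊤ : ℕ∞) w := η.contDiff.comp (contDiff_const_smul _)
    have hwc2 : ContDiff ℝ 2 w := η.contDiff.comp (contDiff_const_smul _)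
    have hw0 : w 0 = 1 := by
      simp only [hw, smul_zero]
      exact η.one_of_mem_closedBall (by simp [η])
    have hwz : ∀ y : Euc n, 2 * ε ≤ ‖y‖ → w y = 0 := fun y hy => by
      apply η.zero_of_le_dist
      rw [dist_zero_right, norm_smul, norm_inv, Real.norm_of_nonneg hε.le, inv_mul_eq_div,
        le_div_iff₀ hε]
      exact hy
    have hts : tsupport w ⊆ closedBall 0 (2 * ε) := by
      refine closure_minimal (fun y hy => ?_) isClosed_closedBall
      rw [mem_closedBall_zero_iff]
      by_contra h
      exact hy (hwz y (not_le.1 h).le)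
    have hcs : HasCompactSupport w :=
      (isCompact_closedBall _ _).of_isClosed_subset (isClosed_tsupport _) hts
    have hb : closedBall (0 : Euc n) (2 * ε) ⊆ ball 0 1 :=
      closedBall_subset_ball (by linarith)
    have hfd : tsupport (fderiv ℝ w) ⊆ {x | ε * 1 ≤ ‖x‖ ∧ ‖x‖ ≤ ε * 2} :=
      tsupport_fderiv_bump_subset η hε
    have hfdU : tsupport (fderiv ℝ w) ⊆ ball (0 : Euc n) 1 \ {0} := fun x hx => by
      have := hfd hx
      refine ⟨hb (by simpa [mul_comm] using this.2), ?_⟩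
      rintro rfl
      have h := this.1
      simp at h
      linarith
    have hI1 : Integrable (fun x => ⟪gradient g x, gradient w x⟫) :=
      integrable_inner_gradient hU hg1 (hwc.of_le (by exact_mod_cast le_top)) hcs hfdU
    have key := hweak w hwc hcs (hts.trans hb)
    rw [hw0] at key
    have hIs : IntegrableOn
        (fun x => ⟪gradient g x, gradient w x⟫ + ⟪B x, gradient g x⟫ * w x) (ball 0 1) := by
      by_contra h
      rw [integral_undef h] at key
      exact zero_ne_one key
    have hI2 : IntegrableOn (fun x => ⟪B x, gradient g x⟫ * w x) (ball 0 1) := by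
      refine (hIs.sub hI1.integrableOn).congr (Eventually.of_forall fun x => ?_)
      simp only [Pi.sub_apply, add_sub_cancel_left]
    rw [integral_add hI1.integrableOn hI2] at key
    have hfirst : ‖∫ x in ball (0 : Euc n) 1, ⟪gradient g x, gradient w x⟫‖ ≤
        |A| * ((ε⁻¹) ^ 2 * C) * ((2 * ε) ^ n * V) := by
      rw [setIntegral_eq_integral_of_forall_compl_eq_zero,
        integral_inner_gradient_eq_neg_mul_laplacian hU hg1
          hwc2 hcs hfdU, norm_neg,
        ← setIntegral_eq_integral_of_forall_compl_eq_zero (s := closedBall 0 (2 * ε))]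
      · have hvol : volume.real (closedBall (0 : Euc n) (2 * ε)) = (2 * ε) ^ n * V := by
          rw [Measure.real, Measure.addHaar_closedBall _ _ (by positivity), ENNReal.toReal_mul,
            ENNReal.toReal_ofReal (by positivity)]
          simp [hV, Measure.real]
        rw [← hvol]
        refine norm_setIntegral_le_of_norm_le_const measure_closedBall_lt_top fun x hx => ?_
        by_cases hx0 : x ∈ tsupport (fderiv ℝ w)
        · have hxU := hfdU hx0
          have hgx := hpos x hxU.1 hxU.2
          have hgA := hA x hxU.2 (lt_of_le_of_lt (mem_closedBall_zero_iff.1 hx) hερ)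
          rw [norm_mul]
          refine mul_le_mul ?_ ?_ (norm_nonneg _) (abs_nonneg _)
          · rw [Real.norm_of_nonneg hgx.le]
            exact hgA.trans (le_abs_self A)
          · rw [hw, coordLaplacian_comp_smul, norm_mul, Real.norm_of_nonneg (by positivity)]
            exact mul_le_mul_of_nonneg_left (hC _) (by positivity)
        · rw [coordLaplacian_eq_zero_of_notMem_tsupport_fderiv hx0]
          simp only [mul_zero, norm_zero]
          positivity
      · intro x hx
        rw [coordLaplacian_eq_zero_of_notMem_tsupport_fderiv, mul_zero]
        intro h
        exact hx (by simpa [mul_comm] using (hfd h).2)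
      · intro x hx
        have : fderiv ℝ w x = 0 := image_eq_zero_of_notMem_tsupport fun h => hx (hfdU h).1
        simp [gradient, this]
    have hsecond : ‖∫ x in ball (0 : Euc n) 1, ⟪B x, gradient g x⟫ * w x‖ ≤
        ∫ x in ball (0 : Euc n) 1 ∩ closedBall 0 (2 * ε), 2 * M * ‖gradient g x‖ := by
      rw [← setIntegral_indicator isClosed_closedBall.measurableSet]
      refine norm_integral_le_of_norm_le
        ((hgi.const_mul (2 * M)).indicator isClosed_closedBall.measurableSet)
        (Eventually.of_forall fun x => ?_)
      by_cases hx : x ∈ closedBall (0 : Euc n) (2 * ε)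
      · rw [indicator_of_mem hx, norm_mul]
        have h1 : ‖w x‖ ≤ 1 := by
          rw [Real.norm_of_nonneg η.nonneg]
          exact η.le_one
        have h2 : ‖⟪B x, gradient g x⟫‖ ≤ 2 * M * ‖gradient g x‖ :=
          (norm_inner_le_norm _ _).trans (mul_le_mul_of_nonneg_right
            (hB.norm_le hβ0 hβ1 ((mem_closedBall_zero_iff.1 hx).trans hε2)) (norm_nonneg _))
        exact (mul_le_of_le_one_right (norm_nonneg _) h1).trans h2
      · rw [indicator_of_notMem hx, image_eq_zero_of_notMem_tsupport fun h => hx (hts h)]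
        simp
    have h1 := (norm_add_le _ _).trans (add_le_add hfirst hsecond)
    rwa [key, norm_one] at h1
  have hlim1 : Tendsto (fun ε : ℝ => |A| * ((ε⁻¹) ^ 2 * C) * ((2 * ε) ^ n * V)) (𝓝[>] 0)
      (𝓝 0) := by
    have h1 : Tendsto (fun ε : ℝ => |A| * C * 2 ^ n * V * ε ^ (n - 2)) (𝓝[>] 0) (𝓝 0) := by
      have : Continuous fun ε : ℝ => |A| * C * 2 ^ n * V * ε ^ (n - 2) := by fun_prop
      have h := this.tendsto 0
      rw [zero_pow (by omega), mul_zero] at h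
      exact h.mono_left nhdsWithin_le_nhds
    refine h1.congr' ?_
    filter_upwards [self_mem_nhdsWithin] with ε hε
    have hε0 : ε ≠ 0 := (show (0 : ℝ) < ε from hε).ne'
    obtain ⟨k, rfl⟩ : ∃ k, n = k + 2 := ⟨n - 2, by omega⟩
    rw [Nat.add_sub_cancel, mul_pow, pow_add ε k 2]
    field_simp
  have hlim2 : Tendsto (fun ε : ℝ => ∫ x in ball (0 : Euc n) 1 ∩ closedBall 0 (2 * ε),
      2 * M * ‖gradient g x‖) (𝓝[>] 0) (𝓝 0) := by
    simp_rw [inter_comm (ball (0 : Euc n) 1),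
      ← Measure.restrict_restrict (μ := volume) (t := ball (0 : Euc n) 1)
        (isClosed_closedBall (x := (0 : Euc n)) (ε := 2 * _)).measurableSet]
    refine Integrable.tendsto_setIntegral_nhds_zero (hgi.const_mul (2 * M)) ?_
    have hfin : Tendsto (fun ε : ℝ => ENNReal.ofReal ((2 * ε) ^ n) * volume (ball (0 : Euc n) 1))
        (𝓝[>] 0) (𝓝 0) := by
      have h1 : Tendsto (fun ε : ℝ => ENNReal.ofReal ((2 * ε) ^ n)) (𝓝[>] 0) (𝓝 0) := by
        have : Continuous fun ε : ℝ => ENNReal.ofReal ((2 * ε) ^ n) :=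
          ENNReal.continuous_ofReal.comp (by fun_prop)
        have h := this.tendsto 0
        rw [mul_zero, zero_pow (by omega), ENNReal.ofReal_zero] at h
        exact h.mono_left nhdsWithin_le_nhds
      simpa using ENNReal.Tendsto.mul_const h1 (Or.inr measure_ball_lt_top.ne)
    refine tendsto_of_tendsto_of_tendsto_of_le_of_le' tendsto_const_nhds hfin
      (Eventually.of_forall fun _ => bot_le) ?_
    filter_upwards [self_mem_nhdsWithin] with ε hε
    have hε0 : (0 : ℝ) < ε := hε
    refine (Measure.restrict_apply_le _ _).trans ?_
    rw [Measure.addHaar_closedBall _ _ (by positivity)]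
    simp
  have hlim := hlim1.add hlim2
  rw [add_zero] at hlim
  have hev : ∀ᶠ ε in 𝓝[>] (0 : ℝ), 1 ≤ |A| * ((ε⁻¹) ^ 2 * C) * ((2 * ε) ^ n * V) +
        ∫ x in ball (0 : Euc n) 1 ∩ closedBall 0 (2 * ε), 2 * M * ‖gradient g x‖ := by
    filter_upwards [Ioo_mem_nhdsGT (show (0 : ℝ) < min (ρ / 2) (1 / 4) by positivity)]
      with ε hε
    exact hbound ε hε.1 (by linarith [hε.2.trans_le (min_le_left _ _)])
      (by linarith [hε.2.trans_le (min_le_right _ _)])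
  exact absurd (ge_of_tendsto hlim hev) (by norm_num)

lemma isPreconnected_ball_diff_zero (hn : 2 ≤ n) (r : ℝ) :
    IsPreconnected (ball (0 : Euc n) r \ {0}) := by
  have hrank : 1 < Module.rank ℝ (Euc n) := by
    rw [← Module.finrank_eq_rank, finrank_euclideanSpace_fin]
    exact_mod_cast hn
  have h1 : IsPreconnected ((fun q : ℝ × Euc n => q.1 • q.2) '' (Ioo 0 r ×ˢ sphere 0 1)) :=
    (isPreconnected_Ioo.prod (isPreconnected_sphere hrank 0 1)).image _ (by fun_prop)
  convert h1 using 1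
  ext x
  constructor
  · rintro ⟨hx, hx0⟩
    have hx0' : 0 < ‖x‖ := norm_pos_iff.2 hx0
    exact ⟨(‖x‖, ‖x‖⁻¹ • x), ⟨⟨hx0', mem_ball_zero_iff.1 hx⟩, by
      simp [norm_smul, hx0'.ne']⟩, by simp [smul_smul, hx0'.ne']⟩
  · rintro ⟨⟨t, y⟩, ⟨⟨ht0, htr⟩, hy⟩, rfl⟩
    simp only [mem_sphere_iff_norm, sub_zero] at hy
    refine ⟨by simpa [norm_smul, hy, abs_of_pos ht0] using htr, ?_⟩
    simp only [mem_singleton_iff, smul_eq_zero, not_or]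
    exact ⟨ht0.ne', norm_ne_zero_iff.1 (by rw [hy]; norm_num)⟩

/-- Inside the sphere through a minimum point, the Green's function exceeds its value there. -/
lemma IsMinPoint.lt_of_norm_lt (hn : 3 ≤ n) {β M : ℝ} (hβ0 : 0 < β) (hβ1 : β < 1)
    {B : Euc n → Euc n} {g : Euc n → ℝ}
    (hB : AdmissibleDrift β M B) (hg : IsGreenPole B 0 g) {p x : Euc n} (hp : IsMinPoint g p)
    (hx0 : x ≠ 0) (hx : ‖x‖ < ‖p‖) : g p < g x := by
  by_contra hle
  obtain ⟨hpb, hp0, hmin⟩ := hp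
  have hp1 : ‖p‖ < 1 := by simpa using hpb
  refine hg.not_bounded_near_pole hn hβ0 hβ1 hB (A := g p) (norm_pos_iff.2 hp0) ?_
  intro y hy0 hy
  by_contra hgy
  have hsub : ball (0 : Euc n) ‖p‖ \ {0} ⊆ ball (0 : Euc n) 1 \ {0} :=
    sdiff_subset_sdiff_left (ball_subset_ball hp1.le)
  obtain ⟨z, hz, hgz⟩ := (isPreconnected_ball_diff_zero (by omega) ‖p‖).intermediate_value
    (f := g) (a := x) (b := y) ⟨by simpa using hx, hx0⟩ ⟨by simpa using hy, hy0⟩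
    (hg.2.1.continuousOn.mono hsub) ⟨not_lt.1 hle, (not_le.1 hgy).le⟩
  have h1 := hmin z (hsub hz).1 hz.2 hgz
  have h2 : ‖z‖ < ‖p‖ := by simpa using hz.1
  linarith

lemma IsMinPoint.le_of_norm_le (hn : 3 ≤ n) {β M : ℝ} (hβ0 : 0 < β) (hβ1 : β < 1)
    {B : Euc n → Euc n} {g : Euc n → ℝ}
    (hB : AdmissibleDrift β M B) (hg : IsGreenPole B 0 g) {p x : Euc n} (hp : IsMinPoint g p)
    (hx0 : x ≠ 0) (hx : ‖x‖ ≤ ‖p‖) : g p ≤ g x := by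
  have hx1 : ‖x‖ < 1 := hx.trans_lt (by simpa using hp.1)
  have hxn : 0 < ‖x‖ := norm_pos_iff.2 hx0
  have hcont : ContinuousAt g x := hg.2.1.continuousOn.continuousAt
    (isOpen_ball_diff_zero.mem_nhds ⟨by simpa using hx1, hx0⟩)
  have ht : Tendsto (fun t : ℝ => g (t • x)) (𝓝[<] 1) (𝓝 (g x)) := by
    have h1 : ContinuousAt (fun t : ℝ => g (t • x)) 1 :=
      ContinuousAt.comp (g := g) (f := fun t : ℝ => t • x) (by simpa using hcont)
        (by fun_prop)
    simpa using h1.tendsto.mono_left nhdsWithin_le_nhds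
  refine ge_of_tendsto ht ?_
  filter_upwards [Ioo_mem_nhdsLT (zero_lt_one (α := ℝ))] with t ht
  refine (hp.lt_of_norm_lt hn hβ0 hβ1 hB hg (smul_ne_zero ht.1.ne' hx0) ?_).le
  rw [norm_smul, Real.norm_of_nonneg ht.1.le]
  nlinarith [ht.2]

end GreenFunction

section MaximumPrinciple

variable {n : ℕ}

lemma deriv_deriv_nonneg_of_isLocalMin {f : ℝ → ℝ} {a : ℝ} (hf : ContinuousAt f a)
    (hmin : IsLocalMin f a) : 0 ≤ deriv (deriv f) a := by
  by_contra h
  have hmax := isLocalMax_of_deriv_deriv_neg (not_le.1 h) hmin.deriv_eq_zero hf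
  have hconst : f =ᶠ[𝓝 a] fun _ => f a := by
    filter_upwards [hmin, hmax] with y h1 h2 using le_antisymm h2 h1
  have h2 : deriv (deriv f) a = 0 := by
    rw [hconst.deriv.deriv_eq]
    simp
  exact h h2.ge

lemma coordLaplacian_nonneg_of_isLocalMin {u : Euc n → ℝ} {x : Euc n}
    (hu : ContDiffAt ℝ 2 u x) (hmin : IsLocalMin u x) : 0 ≤ coordLaplacian u x := by
  refine Finset.sum_nonneg fun i _ => ?_
  set e : Euc n := EuclideanSpace.single i 1
  have hline : Continuous fun t : ℝ => x + t • e := by fun_prop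
  have hx0 : x + (0 : ℝ) • e = x := by simp
  have hd : ∀ t : ℝ, HasDerivAt (fun t : ℝ => x + t • e) e t := fun t => by
    simpa using ((hasDerivAt_id t).smul_const e).const_add x
  have hdiff : ∀ᶠ y in 𝓝 x, DifferentiableAt ℝ u y :=
    (hu.eventually (by simp)).mono fun y hy => hy.differentiableAt two_ne_zero
  have htend : Tendsto (fun t : ℝ => x + t • e) (𝓝 0) (𝓝 x) := by
    simpa [hx0] using hline.tendsto 0
  have hderiv : deriv (fun t : ℝ => u (x + t • e)) =ᶠ[𝓝 0] fun t => fderiv ℝ u (x + t • e) e := by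
    filter_upwards [htend.eventually hdiff] with t ht
    exact (ht.hasFDerivAt.comp_hasDerivAt t (hd t)).deriv
  have hdd : DifferentiableAt ℝ (fun y => fderiv ℝ u y e) x :=
    ((hu.fderiv_right (m := 1) (by norm_num)).differentiableAt one_ne_zero).clm_apply
      (differentiableAt_const e)
  have hsecond : deriv (deriv fun t : ℝ => u (x + t • e)) 0 =
      fderiv ℝ (fun y => fderiv ℝ u y e) x e := by
    rw [hderiv.deriv_eq]
    have h := hdd.hasFDerivAt
    rw [← hx0] at h
    simpa [Function.comp_def] using (h.comp_hasDerivAt (0 : ℝ) (hd 0)).deriv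
  rw [← hsecond]
  refine deriv_deriv_nonneg_of_isLocalMin ?_ ?_
  · exact ContinuousAt.comp (g := u) (f := fun t : ℝ => x + t • e)
      (by rw [hx0]; exact hu.continuousAt) hline.continuousAt
  · have : ∀ᶠ t in 𝓝 (0 : ℝ), u x ≤ u (x + t • e) := htend.eventually hmin
    simpa [IsLocalMin, IsMinFilter, hx0] using this

/-- A weak minimum principle for strict supersolutions of `-Δ + B·∇` on an annulus. -/
lemma nonneg_on_annulus_of_strict_supersolution {B : Euc n → Euc n} {u : Euc n → ℝ} {r R : ℝ}
    (hcont : ContinuousOn u {x | r ≤ ‖x‖ ∧ ‖x‖ ≤ R})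
    (hu : ∀ x, r < ‖x‖ → ‖x‖ < R → ContDiffAt ℝ 2 u x)
    (hsup : ∀ x, r < ‖x‖ → ‖x‖ < R → coordLaplacian u x < ⟪B x, gradient u x⟫)
    (hbdr : ∀ x, ‖x‖ = r → 0 ≤ u x) (hbdR : ∀ x, ‖x‖ = R → 0 ≤ u x)
    {x : Euc n} (hrx : r ≤ ‖x‖) (hxR : ‖x‖ ≤ R) : 0 ≤ u x := by
  have hK : IsCompact {x : Euc n | r ≤ ‖x‖ ∧ ‖x‖ ≤ R} := by
    refine (isCompact_closedBall (0 : Euc n) R).of_isClosed_subset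
      ((isClosed_le continuous_const continuous_norm).inter
        (isClosed_le continuous_norm continuous_const)) fun y hy => ?_
    simpa using hy.2
  obtain ⟨z, hz, hzmin⟩ := hK.exists_isMinOn ⟨x, hrx, hxR⟩ hcont
  refine le_trans ?_ (hzmin ⟨hrx, hxR⟩)
  rcases hz.1.eq_or_lt with h1 | h1
  · exact hbdr z h1.symm
  rcases hz.2.eq_or_lt with h2 | h2
  · exact hbdR z h2
  have hloc : IsLocalMin u z := by
    filter_upwards [(isOpen_lt continuous_const continuous_norm).mem_nhds h1,
      (isOpen_lt continuous_norm continuous_const).mem_nhds h2] with y hy1 hy2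
    exact hzmin ⟨le_of_lt hy1, le_of_lt hy2⟩
  have h3 := coordLaplacian_nonneg_of_isLocalMin (hu z h1 h2) hloc
  have h4 := hsup z h1 h2
  rw [gradient, hloc.fderiv_eq_zero, map_zero, inner_zero_right] at h4
  linarith

end MaximumPrinciple

section Barrier

variable {n : ℕ}

lemma contDiffAt_normSq_rpow (a : ℝ) {x : Euc n} (hx : x ≠ 0) {k : WithTop ℕ∞} :
    ContDiffAt ℝ k (fun y : Euc n => (‖y‖ ^ 2) ^ a) x :=
  (contDiff_norm_sq ℝ).contDiffAt.rpow_const_of_ne (by simpa using hx)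

lemma hasFDerivAt_normSq_rpow (a : ℝ) {x : Euc n} (hx : x ≠ 0) :
    HasFDerivAt (fun y : Euc n => (‖y‖ ^ 2) ^ a)
      ((2 * a * (‖x‖ ^ 2) ^ (a - 1)) • innerSL ℝ x) x := by
  have h1 : HasFDerivAt (fun y : Euc n => ‖y‖ ^ 2) (2 • innerSL ℝ x) x :=
    (hasStrictFDerivAt_norm_sq x).hasFDerivAt
  refine (h1.rpow_const (p := a) (Or.inl (by simpa using hx))).congr_fderiv ?_
  ext v
  simp
  ring

lemma fderiv_normSq_rpow_apply (a : ℝ) {x : Euc n} (hx : x ≠ 0) (v : Euc n) :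
    fderiv ℝ (fun y : Euc n => (‖y‖ ^ 2) ^ a) x v = 2 * a * (‖x‖ ^ 2) ^ (a - 1) * ⟪x, v⟫ := by
  rw [(hasFDerivAt_normSq_rpow a hx).fderiv]
  simp

lemma coordLaplacian_normSq_rpow (a : ℝ) {x : Euc n} (hx : x ≠ 0) :
    coordLaplacian (fun y : Euc n => (‖y‖ ^ 2) ^ a) x =
      2 * a * (n + 2 * a - 2) * (‖x‖ ^ 2) ^ (a - 1) := by
  have hx2 : 0 < ‖x‖ ^ 2 := by positivity
  have hterm : ∀ i : Fin n,
      fderiv ℝ (fun y => fderiv ℝ (fun y : Euc n => (‖y‖ ^ 2) ^ a) y (EuclideanSpace.single i 1)) x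
        (EuclideanSpace.single i 1) =
      2 * a * (2 * (a - 1) * (‖x‖ ^ 2) ^ (a - 1 - 1)) * x i ^ 2 +
        2 * a * (‖x‖ ^ 2) ^ (a - 1) := by
    intro i
    set e : Euc n := EuclideanSpace.single i 1
    have hev : (fun y => fderiv ℝ (fun y : Euc n => (‖y‖ ^ 2) ^ a) y e) =ᶠ[𝓝 x]
        fun y => 2 * a * ((‖y‖ ^ 2) ^ (a - 1) * ⟪e, y⟫) := by
      filter_upwards [isOpen_ne.mem_nhds hx] with y hy
      rw [fderiv_normSq_rpow_apply a hy, real_inner_comm]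
      ring
    have h2 : HasFDerivAt (fun y : Euc n => ⟪e, y⟫) (innerSL ℝ e) x :=
      (innerSL ℝ e).hasFDerivAt
    rw [hev.fderiv_eq, (((hasFDerivAt_normSq_rpow (a - 1) hx).fun_mul h2).const_mul (2 * a)).fderiv]
    have h3 : ⟪x, e⟫ = x i := by simp [e, EuclideanSpace.inner_single_right]
    have h4 : ⟪e, x⟫ = x i := by rw [real_inner_comm, h3]
    have h5 : ⟪e, e⟫ = 1 := by simp [e]
    simp only [add_apply, smul_apply, innerSL_apply_apply, smul_eq_mul, h3, h4, h5]
    ring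
  rw [coordLaplacian, Finset.sum_congr rfl fun i _ => hterm i, Finset.sum_add_distrib,
    ← Finset.mul_sum, ← EuclideanSpace.real_norm_sq_eq, Finset.sum_const, Finset.card_univ,
    Fintype.card_fin, nsmul_eq_mul, Real.rpow_sub_one hx2.ne' (a - 1)]
  field_simp
  ring

lemma fderiv_add_const_mul_add_const {u w : Euc n → ℝ} {x : Euc n} (c d : ℝ)
    (hu : DifferentiableAt ℝ u x) (hw : DifferentiableAt ℝ w x) (v : Euc n) :
    fderiv ℝ (fun y => u y + c * w y + d) x v = fderiv ℝ u x v + c * fderiv ℝ w x v := by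
  rw [((hu.hasFDerivAt.fun_add (hw.hasFDerivAt.const_mul c)).add_const d).fderiv]
  simp

lemma coordLaplacian_add_const_mul_add_const {u w : Euc n → ℝ} {x : Euc n} (c d : ℝ)
    (hu : ContDiffAt ℝ 2 u x) (hw : ContDiffAt ℝ 2 w x) :
    coordLaplacian (fun y => u y + c * w y + d) x =
      coordLaplacian u x + c * coordLaplacian w x := by
  simp only [coordLaplacian, Finset.mul_sum, ← Finset.sum_add_distrib]
  refine Finset.sum_congr rfl fun i _ => ?_
  set e : Euc n := EuclideanSpace.single i 1
  have hd : ∀ f : Euc n → ℝ, ContDiffAt ℝ 2 f x →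
      DifferentiableAt ℝ (fun y => fderiv ℝ f y e) x := fun f hf =>
    ((hf.fderiv_right (m := 1) (by norm_num)).differentiableAt one_ne_zero).clm_apply
      (differentiableAt_const e)
  have hev : (fun y => fderiv ℝ (fun y => u y + c * w y + d) y e) =ᶠ[𝓝 x]
      fun y => fderiv ℝ u y e + c * fderiv ℝ w y e + 0 := by
    filter_upwards [hu.eventually (by simp), hw.eventually (by simp)] with y h1 h2
    rw [fderiv_add_const_mul_add_const c d (h1.differentiableAt two_ne_zero)
      (h2.differentiableAt two_ne_zero), add_zero]
  rw [hev.fderiv_eq, fderiv_add_const_mul_add_const c 0 (hd u hu) (hd w hw)]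

/-- The radial profile `r ^ (2 - n) - A * r ^ (5 / 2 - n)` of a strict subsolution. -/
def barrierProfile (n : ℕ) (A r : ℝ) : ℝ :=
  (r ^ 2) ^ ((2 - n : ℝ) / 2) - A * (r ^ 2) ^ ((5 / 2 - n : ℝ) / 2)

lemma barrierProfile_norm_eq (A : ℝ) : (fun y : Euc n => barrierProfile n A ‖y‖) =
    fun y => (‖y‖ ^ 2) ^ ((2 - n : ℝ) / 2) + (-A) * (‖y‖ ^ 2) ^ ((5 / 2 - n : ℝ) / 2) + 0 := by
  ext y
  simp only [barrierProfile]
  ring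

lemma contDiffAt_barrier (A : ℝ) {x : Euc n} (hx : x ≠ 0) {k : WithTop ℕ∞} :
    ContDiffAt ℝ k (fun y : Euc n => barrierProfile n A ‖y‖) x :=
  (contDiffAt_normSq_rpow _ hx).sub (contDiffAt_const.mul (contDiffAt_normSq_rpow _ hx))

lemma normSq_rpow_eq {r : ℝ} (hr : 0 ≤ r) (a : ℝ) : (r ^ 2) ^ a = r ^ (2 * a) := by
  rw [Real.rpow_mul hr, Real.rpow_two]

lemma fderiv_barrier_apply (A : ℝ) {x : Euc n} (hx : x ≠ 0) (v : Euc n) :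
    fderiv ℝ (fun y : Euc n => barrierProfile n A ‖y‖) x v =
      (-(n - 2) * ‖x‖ ^ (-n : ℝ) + A * (n - 5 / 2) * ‖x‖ ^ (1 / 2 - n : ℝ)) * ⟪x, v⟫ := by
  rw [barrierProfile_norm_eq, fderiv_add_const_mul_add_const _ _
    ((contDiffAt_normSq_rpow _ hx).differentiableAt one_ne_zero)
    ((contDiffAt_normSq_rpow _ hx).differentiableAt one_ne_zero),
    fderiv_normSq_rpow_apply _ hx, fderiv_normSq_rpow_apply _ hx,
    normSq_rpow_eq (norm_nonneg x), normSq_rpow_eq (norm_nonneg x),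
    show (2 * ((2 - n) / 2 - 1) : ℝ) = -n by ring,
    show (2 * ((5 / 2 - n) / 2 - 1) : ℝ) = 1 / 2 - n by ring]
  ring

lemma coordLaplacian_barrier (A : ℝ) {x : Euc n} (hx : x ≠ 0) :
    coordLaplacian (fun y : Euc n => barrierProfile n A ‖y‖) x =
      A * ((n - 5 / 2) / 2) * ‖x‖ ^ (1 / 2 - n : ℝ) := by
  rw [barrierProfile_norm_eq, coordLaplacian_add_const_mul_add_const _ _
    (contDiffAt_normSq_rpow _ hx) (contDiffAt_normSq_rpow _ hx),
    coordLaplacian_normSq_rpow _ hx, coordLaplacian_normSq_rpow _ hx,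
    normSq_rpow_eq (norm_nonneg x), normSq_rpow_eq (norm_nonneg x),
    show (2 * ((5 / 2 - n) / 2 - 1) : ℝ) = 1 / 2 - n by ring]
  ring

lemma two_mul_le_rpow_neg_half {A r : ℝ} (hA : 0 < A) (hr : 0 < r) (hAr : 4 * A ^ 2 * r ≤ 1) :
    2 * A ≤ r ^ (-(1 / 2) : ℝ) := by
  have h1 : (r ^ (-(1 / 2) : ℝ)) ^ 2 = r⁻¹ := by
    rw [← Real.rpow_natCast, ← Real.rpow_mul hr.le, ← Real.rpow_neg_one]
    norm_num
  refine le_of_sq_le_sq ?_ (by positivity)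
  rw [h1, le_inv_comm₀ (by positivity) hr, ← one_div, le_div_iff₀ (by positivity)]
  linarith

/-- The barrier is a strict subsolution for drifts bounded by `K`. -/
lemma inner_gradient_barrier_lt_coordLaplacian (hn : 3 ≤ n) {A K : ℝ} (hA : 0 < A)
    (hAK : K * (n - 2) < A * ((n - 5 / 2) / 2)) {x b : Euc n} (hx : x ≠ 0) (hx1 : ‖x‖ ≤ 1)
    (hAx : 4 * A ^ 2 * ‖x‖ ≤ 1) (hb : ‖b‖ ≤ K) :
    ⟪b, gradient (fun y : Euc n => barrierProfile n A ‖y‖) x⟫ <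
      coordLaplacian (fun y : Euc n => barrierProfile n A ‖y‖) x := by
  have hn' : (3 : ℝ) ≤ n := by exact_mod_cast hn
  have hr : 0 < ‖x‖ := norm_pos_iff.2 hx
  rw [real_inner_comm, inner_gradient_eq_fderiv, fderiv_barrier_apply A hx,
    coordLaplacian_barrier A hx]
  set r := ‖x‖ with hrdef
  have hs := two_mul_le_rpow_neg_half hA hr hAx
  have hs1 : 1 ≤ r ^ (-(1 / 2) : ℝ) := Real.one_le_rpow_of_pos_of_le_one_of_nonpos hr hx1
    (by norm_num)
  set s := r ^ (-(1 / 2) : ℝ) with hsdef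
  set T := r ^ (1 / 2 - n : ℝ) with hTdef
  have hT : 0 < T := Real.rpow_pos_of_pos hr _
  have hTs : r ^ (-n : ℝ) = T * s := by
    rw [hTdef, hsdef, ← Real.rpow_add hr]
    congr 1
    ring
  have hsr : s * s * r = 1 := by
    rw [hsdef, ← Real.rpow_add hr, show (-(1 / 2) + -(1 / 2) : ℝ) = -1 by norm_num,
      Real.rpow_neg_one, inv_mul_cancel₀ hr.ne']
  have hin : |⟪x, b⟫| ≤ r * K := (abs_real_inner_le_norm x b).trans
    (mul_le_mul_of_nonneg_left hb hr.le)
  have hK : 0 ≤ K := (norm_nonneg b).trans hb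
  have hcoef : |-(n - 2) * (T * s) + A * (n - 5 / 2) * T| ≤ (n - 2) * (T * s) := by
    have h1 : A * (n - 5 / 2) * T ≤ (n - 2) * (T * s) := by
      have : A * (n - 5 / 2) ≤ (n - 2) * s := by nlinarith
      nlinarith
    have h2 : 0 ≤ A * (n - 5 / 2) * T := by
      have : (0 : ℝ) ≤ n - 5 / 2 := by linarith
      positivity
    rw [abs_le]
    constructor <;> linarith
  rw [hTs]
  calc (-(n - 2) * (T * s) + A * (n - 5 / 2) * T) * ⟪x, b⟫
      ≤ |-(n - 2) * (T * s) + A * (n - 5 / 2) * T| * |⟪x, b⟫| := by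
        rw [← abs_mul]
        exact le_abs_self _
    _ ≤ (n - 2) * (T * s) * (r * K) := mul_le_mul hcoef hin (abs_nonneg _)
        ((abs_nonneg _).trans hcoef)
    _ = K * (n - 2) * T * (s * r) := by ring
    _ ≤ K * (n - 2) * T * 1 := by
        have h2 : (0 : ℝ) ≤ n - 2 := by linarith
        refine mul_le_mul_of_nonneg_left ?_ (by positivity)
        nlinarith [mul_pos (zero_lt_one.trans_le hs1) hr]
    _ < A * ((n - 5 / 2) / 2) * T := by
        rw [mul_one]
        exact mul_lt_mul_of_pos_right hAK hT

/-- The barrier decays at least half as fast as the fundamental solution of the Laplacian. -/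
lemma half_rpow_sub_le_barrierProfile_sub (hn : 3 ≤ n) {A r R : ℝ} (hA : 0 < A) (hr : 0 < r)
    (hrR : r ≤ R) (hAR : 4 * A ^ 2 * R ≤ 1) :
    1 / 2 * (r ^ ((2 : ℝ) - n) - R ^ ((2 : ℝ) - n)) ≤
      barrierProfile n A r - barrierProfile n A R := by
  have hn' : (3 : ℝ) ≤ n := by exact_mod_cast hn
  have hR : 0 < R := hr.trans_le hrR
  have hprof : ∀ t : ℝ, 0 < t → barrierProfile n A t - 1 / 2 * t ^ ((2 : ℝ) - n) =
      t ^ ((5 / 2 : ℝ) - n) * (1 / 2 * t ^ (-(1 / 2) : ℝ) - A) := fun t ht => by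
    have h1 : t ^ ((2 : ℝ) - n) = t ^ ((5 / 2 : ℝ) - n) * t ^ (-(1 / 2) : ℝ) := by
      rw [← Real.rpow_add ht]
      congr 1
      ring
    rw [barrierProfile, normSq_rpow_eq ht.le, normSq_rpow_eq ht.le, mul_div_cancel₀ _ two_ne_zero,
      mul_div_cancel₀ _ two_ne_zero, h1]
    ring
  have h1 : R ^ ((5 / 2 : ℝ) - n) ≤ r ^ ((5 / 2 : ℝ) - n) :=
    Real.rpow_le_rpow_of_nonpos hr hrR (by linarith)
  have h2 : R ^ (-(1 / 2) : ℝ) ≤ r ^ (-(1 / 2) : ℝ) :=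
    Real.rpow_le_rpow_of_nonpos hr hrR (by norm_num)
  have h3 := two_mul_le_rpow_neg_half hA hR hAR
  have h4 := mul_le_mul h1
    (show 1 / 2 * R ^ (-(1 / 2) : ℝ) - A ≤ 1 / 2 * r ^ (-(1 / 2) : ℝ) - A by linarith)
    (by linarith) (Real.rpow_pos_of_pos hr _).le
  rw [← hprof r hr, ← hprof R hR] at h4
  linarith

end Barrier

section MinimumPoints

variable {n : ℕ}

/-- At a minimum point the Green's function does not increase radially. -/
lemma IsMinPoint.fderiv_self_nonpos (hn : 3 ≤ n) {β M : ℝ} (hβ0 : 0 < β) (hβ1 : β < 1)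
    {B : Euc n → Euc n} {g : Euc n → ℝ}
    (hB : AdmissibleDrift β M B) (hg : IsGreenPole B 0 g) {p : Euc n} (hp : IsMinPoint g p) :
    fderiv ℝ g p p ≤ 0 := by
  have hd : DifferentiableAt ℝ g p := (hg.2.1.contDiffAt
    (isOpen_ball_diff_zero.mem_nhds ⟨hp.1, hp.2.1⟩)).differentiableAt (by norm_num)
  have hmin : IsLocalMinOn g {x | x ≠ 0 ∧ ‖x‖ ≤ ‖p‖} p :=
    eventually_of_mem self_mem_nhdsWithin fun x hx => hp.le_of_norm_le hn hβ0 hβ1 hB hg hx.1 hx.2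
  have h := hmin.hasFDerivWithinAt_nonneg hd.hasFDerivAt.hasFDerivWithinAt
    (y := -(1 / 2 : ℝ) • p) (mem_posTangentConeAt_of_segment_subset ?_)
  · simp only [map_smul, smul_eq_mul] at h
    linarith
  · rw [segment_eq_image']
    rintro _ ⟨t, ht, rfl⟩
    have h1 : p + t • (p + -(1 / 2 : ℝ) • p - p) = (1 - t / 2) • p := by module
    have h2 : 0 < 1 - t / 2 := by linarith [ht.2]
    simp only [h1, mem_ofPred_eq]
    refine ⟨smul_ne_zero h2.ne' hp.2.1, ?_⟩
    rw [norm_smul, Real.norm_of_nonneg h2.le]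
    nlinarith [ht.1, norm_nonneg p]

lemma abs_radialDeriv_eq (g : Euc n → ℝ) (p : Euc n) :
    |radialDeriv g p| = ‖p‖⁻¹ * |fderiv ℝ g p p| := by
  rw [radialDeriv, inner_smul_right, inner_gradient_eq_fderiv, abs_mul,
    abs_of_nonneg (inv_nonneg.2 (norm_nonneg p))]

/-- The values at minimum points decay at least as fast as a multiple of the barrier profile
whose size is controlled from below by the radial derivative at the innermost point. -/
lemma exists_barrier_multiple_le (hn : 3 ≤ n) {β M A : ℝ} (hβ0 : 0 < β) (hβ1 : β < 1)
    (hA : 0 < A) (hAM : 2 * M * (n - 2) < A * ((n - 5 / 2) / 2))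
    {B : Euc n → Euc n} {g : Euc n → ℝ} (hB : AdmissibleDrift β M B) (hg : IsGreenPole B 0 g)
    {p₀ p₁ p₂ : Euc n} (hp₀ : IsMinPoint g p₀) (hp₂ : IsMinPoint g p₂)
    (h01 : ‖p₀‖ ≤ ‖p₁‖) (h12 : ‖p₁‖ ≤ ‖p₂‖) (h02 : ‖p₀‖ < ‖p₂‖)
    (h2 : ‖p₂‖ ≤ 1 / 2) (hA2 : 4 * A ^ 2 * ‖p₂‖ ≤ 1) :
    ∃ c > 0, |radialDeriv g p₀| * ‖p₀‖ ^ (n - 1) ≤ c * (n - 2) ∧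
      c * (barrierProfile n A ‖p₁‖ - barrierProfile n A ‖p₂‖) ≤ g p₁ - g p₂ := by
  have hn' : (3 : ℝ) ≤ n := by exact_mod_cast hn
  have hr0 : 0 < ‖p₀‖ := norm_pos_iff.2 hp₀.2.1
  have hne : ∀ x : Euc n, ‖p₀‖ ≤ ‖x‖ → x ≠ 0 := fun x hx => norm_pos_iff.1 (hr0.trans_le hx)
  have hψ : 0 < barrierProfile n A ‖p₀‖ - barrierProfile n A ‖p₂‖ := by
    have h1 := half_rpow_sub_le_barrierProfile_sub hn hA hr0 h02.le hA2
    have h3 : ‖p₂‖ ^ ((2 : ℝ) - n) < ‖p₀‖ ^ ((2 : ℝ) - n) :=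
      Real.rpow_lt_rpow_of_neg hr0 h02 (by linarith)
    linarith
  have hg02 : 0 < g p₀ - g p₂ :=
    sub_pos.2 (hp₂.lt_of_norm_lt hn hβ0 hβ1 hB hg hp₀.2.1 h02)
  set ψ₂ := barrierProfile n A ‖p₂‖ with hψ₂
  set c := (g p₀ - g p₂) / (barrierProfile n A ‖p₀‖ - ψ₂) with hc
  have hc0 : 0 < c := div_pos hg02 hψ
  have hcψ : c * (barrierProfile n A ‖p₀‖ - ψ₂) = g p₀ - g p₂ := div_mul_cancel₀ _ hψ.ne'
  set d := c * ψ₂ - g p₂ with hd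
  set u : Euc n → ℝ := fun y => g y + (-c) * barrierProfile n A ‖y‖ + d with hu
  have hgC : ∀ x : Euc n, ‖p₀‖ ≤ ‖x‖ → ‖x‖ ≤ ‖p₂‖ → ContDiffAt ℝ 2 g x := fun x h0 h1 =>
    (hg.2.1.contDiffAt (isOpen_ball_diff_zero.mem_nhds
      ⟨by rw [mem_ball_zero_iff]; linarith, hne x h0⟩)).of_le (by norm_num)
  have hφC : ∀ x : Euc n, ‖p₀‖ ≤ ‖x‖ →
      ContDiffAt ℝ 2 (fun y : Euc n => barrierProfile n A ‖y‖) x := fun x h0 =>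
    contDiffAt_barrier A (hne x h0)
  have huC : ∀ x : Euc n, ‖p₀‖ ≤ ‖x‖ → ‖x‖ ≤ ‖p₂‖ → ContDiffAt ℝ 2 u x := fun x h0 h1 =>
    ((hgC x h0 h1).add (contDiffAt_const.mul (hφC x h0))).add contDiffAt_const
  have hnonneg : ∀ x : Euc n, ‖p₀‖ ≤ ‖x‖ → ‖x‖ ≤ ‖p₂‖ → 0 ≤ u x := by
    intro x h0 h1
    refine nonneg_on_annulus_of_strict_supersolution (B := B)
      (fun y hy => (huC y hy.1 hy.2).continuousAt.continuousWithinAt)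
      (fun y hy0 hy2 => huC y hy0.le hy2.le) ?_ ?_ ?_ h0 h1
    · intro y hy0 hy2
      have hy : y ≠ 0 := hne y hy0.le
      have hstrict := inner_gradient_barrier_lt_coordLaplacian hn hA hAM (b := B y) hy
        (by linarith) ((mul_le_mul_of_nonneg_left hy2.le (by positivity)).trans hA2)
        (hB.norm_le hβ0 hβ1 (by linarith))
      rw [coordLaplacian_add_const_mul_add_const _ _ (hgC y hy0.le hy2.le) (hφC y hy0.le),
        hg.coordLaplacian_eq hB ⟨by rw [mem_ball_zero_iff]; linarith, hy⟩,
        real_inner_comm _ (B y), real_inner_comm _ (B y), inner_gradient_eq_fderiv,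
        inner_gradient_eq_fderiv, fderiv_add_const_mul_add_const _ _
        ((hgC y hy0.le hy2.le).differentiableAt two_ne_zero)
        ((hφC y hy0.le).differentiableAt two_ne_zero)]
      rw [real_inner_comm, inner_gradient_eq_fderiv] at hstrict
      nlinarith
    · intro y hy
      have h1 := hp₀.le_of_norm_le hn hβ0 hβ1 hB hg (hne y hy.ge) hy.le
      simp only [hu, hy]
      linarith
    · intro y hy
      have h1 := hp₂.le_of_norm_le hn hβ0 hβ1 hB hg (hne y (hy ▸ h02.le)) hy.le
      simp only [hu, hy, ← hψ₂]
      linarith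
  refine ⟨c, hc0, ?_, ?_⟩
  · have hu0 : u p₀ = 0 := by
      simp only [hu]
      linarith
    have hmin : IsLocalMinOn u {x | ‖p₀‖ ≤ ‖x‖ ∧ ‖x‖ ≤ ‖p₂‖} p₀ :=
      eventually_of_mem self_mem_nhdsWithin fun x hx => hu0 ▸ hnonneg x hx.1 hx.2
    have hq : 0 < ‖p₂‖ / ‖p₀‖ - 1 := sub_pos.2 ((one_lt_div hr0).2 h02)
    have h := hmin.hasFDerivWithinAt_nonneg
      ((huC p₀ le_rfl h02.le).differentiableAt two_ne_zero).hasFDerivAt.hasFDerivWithinAt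
      (y := (‖p₂‖ / ‖p₀‖ - 1) • p₀) (mem_posTangentConeAt_of_segment_subset ?_)
    · rw [map_smul, smul_eq_mul, mul_nonneg_iff_of_pos_left hq,
        fderiv_add_const_mul_add_const _ _ ((hgC p₀ le_rfl h02.le).differentiableAt two_ne_zero)
        ((hφC p₀ le_rfl).differentiableAt two_ne_zero), fderiv_barrier_apply A hp₀.2.1,
        real_inner_self_eq_norm_sq] at h
      have hneg := hp₀.fderiv_self_nonpos hn hβ0 hβ1 hB hg
      have hpos : 0 ≤ c * (A * (n - 5 / 2) * ‖p₀‖ ^ (1 / 2 - n : ℝ) * ‖p₀‖ ^ 2) := by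
        have : (0 : ℝ) ≤ n - 5 / 2 := by linarith
        positivity
      have habs : |fderiv ℝ g p₀ p₀| ≤ c * (n - 2) * (‖p₀‖ ^ (-n : ℝ) * ‖p₀‖ ^ 2) := by
        rw [abs_of_nonpos hneg]
        linarith
      have hpow : ‖p₀‖ ^ (-n : ℝ) * ‖p₀‖ ^ 2 * (‖p₀‖⁻¹ * ‖p₀‖ ^ (n - 1)) = 1 := by
        obtain ⟨k, rfl⟩ : ∃ k, n = k + 1 := ⟨n - 1, by omega⟩
        rw [Real.rpow_neg hr0.le, Real.rpow_natCast, Nat.add_sub_cancel, pow_succ]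
        field_simp
      calc |radialDeriv g p₀| * ‖p₀‖ ^ (n - 1)
          = |fderiv ℝ g p₀ p₀| * (‖p₀‖⁻¹ * ‖p₀‖ ^ (n - 1)) := by
            rw [abs_radialDeriv_eq]
            ring
        _ ≤ c * (n - 2) * (‖p₀‖ ^ (-n : ℝ) * ‖p₀‖ ^ 2) * (‖p₀‖⁻¹ * ‖p₀‖ ^ (n - 1)) :=
            mul_le_mul_of_nonneg_right habs (by positivity)
        _ = c * (n - 2) := by rw [mul_assoc, hpow, mul_one]
    · rw [segment_eq_image']
      rintro _ ⟨t, ht, rfl⟩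
      have h1 : p₀ + t • (p₀ + (‖p₂‖ / ‖p₀‖ - 1) • p₀ - p₀) =
          (1 + t * (‖p₂‖ / ‖p₀‖ - 1)) • p₀ := by module
      have h3 : 0 ≤ t * (‖p₂‖ / ‖p₀‖ - 1) := mul_nonneg ht.1 hq.le
      have h4 : (1 + (‖p₂‖ / ‖p₀‖ - 1)) * ‖p₀‖ = ‖p₂‖ := by
        field_simp
        ring
      simp only [h1, mem_ofPred_eq, norm_smul, Real.norm_of_nonneg (by linarith : 0 ≤ 1 +
        t * (‖p₂‖ / ‖p₀‖ - 1))]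
      constructor
      · nlinarith
      · refine le_trans (mul_le_mul_of_nonneg_right ?_ hr0.le) h4.le
        nlinarith [ht.2]
  · have h := hnonneg p₁ h01 h12
    simp only [hu] at h
    linarith

end MinimumPoints

/-- there are constants `L ≥ 2` and `C > 0`, depending only on `n`, `M`, `β`,
such that for every admissible drift, every Green's function `g` with pole at `0`, and all
minimum points `p₀, p₁, p₂` with `0 < |p₀| ≤ |p₁| ≤ |p₂| ≤ 1/L`, one has
`g(p₁) - g(p₂) ≥ 2C |∂g/∂r(p₀)| |p₀|^{n-1} (|p₁|^{2-n} - |p₂|^{2-n})`. -/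
theorem min_point_decay_inequality
    (n : ℕ) (hn : 3 ≤ n) (β M : ℝ) (hβ0 : 0 < β) (hβ1 : β < 1) (hM : 0 < M) :
    ∃ L C : ℝ, 2 ≤ L ∧ 0 < C ∧
      ∀ (B : Euc n → Euc n) (g : Euc n → ℝ),
        AdmissibleDrift β M B → IsGreenPole B (0 : Euc n) g →
        ∀ p₀ p₁ p₂ : Euc n, IsMinPoint g p₀ → IsMinPoint g p₁ → IsMinPoint g p₂ →
          ‖p₀‖ ≤ ‖p₁‖ → ‖p₁‖ ≤ ‖p₂‖ → ‖p₂‖ ≤ 1 / L →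
          g p₁ - g p₂ ≥
            2 * C * (|radialDeriv g p₀| * ‖p₀‖ ^ (n - 1)) *
              (‖p₁‖ ^ ((2 : ℝ) - n) - ‖p₂‖ ^ ((2 : ℝ) - n)) := by
  have hn' : (3 : ℝ) ≤ n := by exact_mod_cast hn
  obtain ⟨A, hA, hAM⟩ : ∃ A : ℝ, 0 < A ∧ 2 * M * (n - 2) < A * ((n - 5 / 2) / 2) := by
    have h1 : (0 : ℝ) < (n - 5 / 2) / 2 := by linarith
    have h2 : (0 : ℝ) < n - 2 := by linarith
    refine ⟨(2 * M * (n - 2) + 1) / ((n - 5 / 2) / 2), by positivity, ?_⟩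
    rw [div_mul_cancel₀ _ h1.ne']
    linarith
  refine ⟨4 * A ^ 2 + 2, 1 / (4 * (n - 2)), by nlinarith [sq_nonneg A],
    div_pos one_pos (by linarith), ?_⟩
  intro B g hB hg p₀ p₁ p₂ hp₀ hp₁ hp₂ h01 h12 hL
  have hL' : ‖p₂‖ * (4 * A ^ 2 + 2) ≤ 1 := by
    rwa [le_div_iff₀ (by positivity)] at hL
  have hr2 := norm_nonneg p₂
  have hr1 : 0 < ‖p₁‖ := norm_pos_iff.2 hp₁.2.1
  have hA2 : 4 * A ^ 2 * ‖p₂‖ ≤ 1 := by nlinarith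
  have h2 : ‖p₂‖ ≤ 1 / 2 := by nlinarith [mul_nonneg hr2 (sq_nonneg A)]
  rcases (h01.trans h12).eq_or_lt with h02 | h02
  · have h12' : ‖p₁‖ = ‖p₂‖ := le_antisymm h12 (h02 ▸ h01)
    rw [h12', sub_self, mul_zero]
    exact sub_nonneg.2 (hp₂.le_of_norm_le hn hβ0 hβ1 hB hg hp₁.2.1 h12)
  · obtain ⟨c, hc, hrad, hdecay⟩ :=
      exists_barrier_multiple_le hn hβ0 hβ1 hA hAM hB hg hp₀ hp₂ h01 h12 h02 h2 hA2
    have hhalf := half_rpow_sub_le_barrierProfile_sub hn hA hr1 h12 hA2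
    have hD : 0 ≤ ‖p₁‖ ^ ((2 : ℝ) - n) - ‖p₂‖ ^ ((2 : ℝ) - n) :=
      sub_nonneg.2 (Real.rpow_le_rpow_of_nonpos hr1 h12 (by linarith))
    have hn2 : (0 : ℝ) < n - 2 := by linarith
    calc 2 * (1 / (4 * (n - 2))) * (|radialDeriv g p₀| * ‖p₀‖ ^ (n - 1)) *
          (‖p₁‖ ^ ((2 : ℝ) - n) - ‖p₂‖ ^ ((2 : ℝ) - n))
        ≤ 2 * (1 / (4 * (n - 2))) * (c * (n - 2)) *
          (‖p₁‖ ^ ((2 : ℝ) - n) - ‖p₂‖ ^ ((2 : ℝ) - n)) := by gcongr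
      _ = c * (1 / 2 * (‖p₁‖ ^ ((2 : ℝ) - n) - ‖p₂‖ ^ ((2 : ℝ) - n))) := by
        field_simp
        ring
      _ ≤ c * (barrierProfile n A ‖p₁‖ - barrierProfile n A ‖p₂‖) :=
        mul_le_mul_of_nonneg_left hhalf hc.le
      _ ≤ g p₁ - g p₂ := hdecay
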